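/- Let F be a nonnegative random variable with E[F^{1+δ}] < ∞ for some δ > 0 and E[F] > 0. Then lim_{r→2⁻} (1 − r/2)^{−1}·(E[F^{2/r}] − (E[F])^{2/r}) = E[F log F] − E[F]·log(E[F]), with the convention 0·log 0 = 0. -/

import Mathlib

open MeasureTheory Filter

theorem hasDerivAt_const_rpow_of_nonneg {x p : ℝ} (hx : 0 ≤ x) (hp : 0 < p) :
    HasDerivAt (fun q : ℝ => x ^ q) (x ^ p * Real.log x) p := by
  rcases hx.eq_or_lt with rfl | hx
  · rw [Real.log_zero, mul_zero]
    refine (hasDerivAt_const p (0 : ℝ)).congr_of_eventuallyEq ?_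
    filter_upwards [eventually_gt_nhds hp] with q hq
    exact Real.zero_rpow hq.ne'
  · exact (Real.hasStrictDerivAt_const_rpow hx p).hasDerivAt

theorem abs_rpow_mul_log_le {x p δ : ℝ} (hx : 0 ≤ x) (hδ : 0 < δ)
    (hp : p ∈ Set.Ioo (1 / 2) (1 + δ / 2)) :
    |x ^ p * Real.log x| ≤ 2 + 2 / δ * x ^ (1 + δ) := by
  obtain ⟨hp₁, hp₂⟩ := hp
  have hnonneg : 0 ≤ 2 / δ * x ^ (1 + δ) := by positivity
  rcases hx.eq_or_lt with rfl | hx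
  · rw [Real.log_zero, mul_zero, abs_zero]
    positivity
  rcases le_total x 1 with hx1 | hx1
  · have h := Real.abs_log_mul_self_rpow_lt x p hx hx1 (by linarith)
    have h2 : 1 / p ≤ 2 := by
      rw [div_le_iff₀ (by linarith)]
      linarith
    rw [mul_comm]
    linarith
  · rw [abs_of_nonneg (mul_nonneg (Real.rpow_nonneg hx.le _) (Real.log_nonneg hx1))]
    calc x ^ p * Real.log x
        ≤ x ^ (1 + δ / 2) * (x ^ (δ / 2) / (δ / 2)) :=
          mul_le_mul (Real.rpow_le_rpow_of_exponent_le hx1 hp₂.le)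
            (Real.log_le_rpow_div hx.le (by positivity)) (Real.log_nonneg hx1) (by positivity)
      _ = 2 / δ * x ^ (1 + δ) := by
          rw [show 1 + δ = (1 + δ / 2) + δ / 2 by ring, Real.rpow_add hx (1 + δ / 2)]
          field_simp
      _ ≤ 2 + 2 / δ * x ^ (1 + δ) := by linarith

/-- The moment function `p ↦ E[F ^ p]` has derivative `E[F log F]` at `p = 1`. -/
theorem hasDerivAt_integral_rpow_one {Ω : Type*} [MeasurableSpace Ω] {P : Measure Ω}
    [IsFiniteMeasure P] {F : Ω → ℝ} (hFmeas : Measurable F) (hFnonneg : ∀ ω, 0 ≤ F ω)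
    {δ : ℝ} (hδ : 0 < δ) (hFint : Integrable (fun ω => F ω ^ (1 + δ)) P)
    (hF : Integrable F P) :
    HasDerivAt (fun p : ℝ => ∫ ω, F ω ^ p ∂P) (∫ ω, F ω * Real.log (F ω) ∂P) 1 := by
  have h := (hasDerivAt_integral_of_dominated_loc_of_deriv_le (μ := P) (x₀ := (1 : ℝ))
    (s := Set.Ioo (1 / 2) (1 + δ / 2)) (F := fun p ω => F ω ^ p)
    (F' := fun p ω => F ω ^ p * Real.log (F ω))
    (bound := fun ω => 2 + 2 / δ * F ω ^ (1 + δ))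
    (Ioo_mem_nhds (by norm_num) (by linarith))
    (Eventually.of_forall fun p => (hFmeas.pow_const p).aestronglyMeasurable)
    (by simpa using hF)
    ((hFmeas.pow_const 1).mul hFmeas.log).aestronglyMeasurable
    (ae_of_all _ fun ω p hp => abs_rpow_mul_log_le (hFnonneg ω) hδ hp)
    ((integrable_const _).add (hFint.const_mul _))
    (ae_of_all _ fun ω p hp =>
      hasDerivAt_const_rpow_of_nonneg (hFnonneg ω) (by linarith [hp.1]))).2
  simpa only [Real.rpow_one] using h

/-- Let `F` be a nonnegative random variable with `E[F^{1+δ}] < ∞` for some `δ > 0` and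
`E[F] > 0`. Then `lim_{r→2⁻} (1 − r/2)⁻¹·(E[F^{2/r}] − (E[F])^{2/r})
= E[F log F] − E[F]·log(E[F])` (with the convention `0·log 0 = 0`). -/
theorem entropy_limit {Ω : Type*} [MeasurableSpace Ω] (P : Measure Ω) [IsProbabilityMeasure P]
    (F : Ω → ℝ) (hFmeas : Measurable F) (hFnonneg : ∀ ω, 0 ≤ F ω)
    (δ : ℝ) (hδ : 0 < δ) (hFint : Integrable (fun ω => F ω ^ (1 + δ)) P)
    (hmean : 0 < ∫ ω, F ω ∂P) :
    Tendsto (fun r : ℝ =>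
        (1 - r / 2)⁻¹ * ((∫ ω, F ω ^ (2 / r) ∂P) - (∫ ω, F ω ∂P) ^ (2 / r)))
      (nhdsWithin 2 (Set.Iio 2))
      (nhds ((∫ ω, F ω * Real.log (F ω) ∂P) -
        (∫ ω, F ω ∂P) * Real.log (∫ ω, F ω ∂P))) := by
  have hF : Integrable F P := by
    by_contra h
    exact hmean.ne' (integral_undef h)
  have hG := (hasDerivAt_integral_rpow_one hFmeas hFnonneg hδ hFint hF).sub
    (hasDerivAt_const_rpow_of_nonneg hmean.le one_pos)
  rw [Real.rpow_one] at hG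
  have hr : HasDerivAt (fun r : ℝ => 2 / r) (-2⁻¹) 2 := by
    simp only [div_eq_mul_inv]
    exact ((hasDerivAt_inv two_ne_zero).const_mul (2 : ℝ)).congr_deriv (by norm_num)
  have hH := HasDerivAt.comp_of_eq (2 : ℝ) hG hr (by norm_num)
  have hlim := ((hasDerivAt_iff_tendsto_slope.1 hH).mono_left
    (nhdsWithin_mono 2 (show Set.Iio (2 : ℝ) ⊆ {2}ᶜ from fun r hr => ne_of_lt hr))).const_mul (-2)
  rw [show ∀ a : ℝ, -2 * (a * -2⁻¹) = a by intro a; ring] at hlim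
  refine hlim.congr' ?_
  filter_upwards [self_mem_nhdsWithin] with r hr
  have hr' : r - 2 ≠ 0 := sub_ne_zero.2 (ne_of_lt hr)
  have hinv : (1 - r / 2)⁻¹ = -2 * (r - 2)⁻¹ := by
    rw [show 1 - r / 2 = -(r - 2) / 2 by ring]
    field_simp
  simp [slope_def_field, hinv]
  ring
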